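/- Let s ≥ 7, let η ∈ ℋ^{s+4} satisfy condition (H), let g solve the filtered Vlasov-HMF equation with Q_{0,s}(g) ≤ R₀ and ε small enough so that sup_{T≥0} Q_{T,s}(g) ≤ R, and set f(t,x,v) = η(v) + ε g(t, x−tv, v). Then there is a constant C such that for every n ∈ ℤ with n ≠ 0, every ξ ∈ ℝ, every t ≥ 0 and all nonnegative integers α, β with α + β = s − 4: |f̂_n(t,ξ)| ≤ C ε / (⟨ξ + nt⟩^α ⟨n⟩^β). In particular every nonzero spatial Fourier mode of f decays to zero with a polynomial rate (nonlinear Landau damping). -/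

import Mathlib

open MeasureTheory Real Set

noncomputable section

/-- The measure on `𝕋 × ℝ`, with `𝕋 = ℝ/2πℤ` modeled as `(0, 2π] × ℝ ⊆ ℝ × ℝ`. -/
def μTR : Measure (ℝ × ℝ) := (volume.restrict (Set.Ioc 0 (2 * π))).prod volume

/-- Partial derivative in the first (space) variable. -/
def pX (f : ℝ → ℝ → ℂ) : ℝ → ℝ → ℂ := fun x v => deriv (fun x' => f x' v) x

/-- Partial derivative in the second (velocity) variable. -/
def pV (f : ℝ → ℝ → ℂ) : ℝ → ℝ → ℂ := fun x v => deriv (fun v' => f x v') v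

/-- The weighted integrand `(1+v²)^{m₀} |∂ₓᵖ ∂ᵥ^q f|²`. -/
def wInt (m0 : ℝ) (p q : ℕ) (f : ℝ → ℝ → ℂ) : ℝ × ℝ → ℝ :=
  fun z => (1 + z.2 ^ 2) ^ m0 * ‖(pX^[p] (pV^[q] f)) z.1 z.2‖ ^ 2

/-- Square of the weighted Sobolev norm: `‖f‖_{ℋⁿ}² = ∑_{p+q ≤ n} ∫ (1+v²)^{m₀}|∂ₓᵖ∂ᵥ^q f|²`. -/
def HnormSq (m0 : ℝ) (n : ℕ) (f : ℝ → ℝ → ℂ) : ℝ :=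
  ∑ p ∈ Finset.range (n + 1), ∑ q ∈ Finset.range (n + 1 - p), ∫ z, wInt m0 p q f z ∂μTR

/-- The weighted Sobolev norm `‖f‖_{ℋⁿ}`. -/
def Hnorm (m0 : ℝ) (n : ℕ) (f : ℝ → ℝ → ℂ) : ℝ := Real.sqrt (HnormSq m0 n f)

/-- Membership in the weighted Sobolev space `ℋⁿ` on `𝕋 × ℝ`. -/
def MemH (m0 : ℝ) (n : ℕ) (f : ℝ → ℝ → ℂ) : Prop :=
  ContDiff ℝ n (Function.uncurry f) ∧
  (∀ v, Function.Periodic (fun x => f x v) (2 * π)) ∧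
  ∀ p q : ℕ, p + q ≤ n → Integrable (wInt m0 p q f) μTR

/-- The Fourier coefficient `f̂ₖ(ξ) = (1/2π) ∫_{𝕋×ℝ} f(x,v) e^{-ikx-iξv} dx dv`. -/
def fHat (f : ℝ → ℝ → ℂ) (k : ℤ) (ξ : ℝ) : ℂ :=
  (1 / (2 * π)) * ∫ z, f z.1 z.2 * Complex.exp (-Complex.I * ((k : ℝ) * z.1 + ξ * z.2)) ∂μTR

/-- The Japanese bracket `⟨t⟩ = (1+t²)^{1/2}`. -/
def jap (t : ℝ) : ℝ := Real.sqrt (1 + t ^ 2)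

/-- The Fourier transform `η̂₀(ξ)` of a spatially homogeneous state `η = η(v)`. -/
def etaHat (η : ℝ → ℂ) (ξ : ℝ) : ℂ := fHat (fun _ v => η v) 0 ξ

/-- Fourier coefficients of the HMF kernel `P(x) = cos x`: `p_{±1} = 1/2`, `pₙ = 0` otherwise. -/
def pcoef (n : ℤ) : ℂ := if n = 1 ∨ n = -1 then 1 / 2 else 0

/-- The kernel `K(n,t) = -n pₙ · nt · η̂₀(nt) 1_{t ≥ 0}`. -/
def Kker (η : ℝ → ℂ) (n : ℤ) (t : ℝ) : ℂ :=
  if 0 ≤ t then -(n : ℂ) * pcoef n * ((n : ℂ) * t) * etaHat η ((n : ℝ) * t) else 0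

/-- The Fourier transform `K̂(n,τ) = ∫_ℝ e^{-iτt} K(n,t) dt`, for complex `τ`. -/
def KhatC (η : ℝ → ℂ) (n : ℤ) (τ : ℂ) : ℂ :=
  ∫ t : ℝ, Complex.exp (-Complex.I * τ * (t : ℂ)) * Kker η n t

/-- The Penrose stability condition (H). -/
def Penrose (m0 : ℝ) (η : ℝ → ℂ) : Prop :=
  MemH m0 5 (fun _ v => (1 + (v : ℂ) ^ 2) * η v) ∧
  ∃ κ > 0, ∀ n : ℤ, n = 1 ∨ n = -1 → ∀ τ : ℂ, τ.im ≤ 0 → κ ≤ ‖1 - KhatC η n τ‖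

/-- The Poisson bracket `{f,h} = ∂ₓf ∂ᵥh - ∂ᵥf ∂ₓh`. -/
def pbracket (f h : ℝ → ℝ → ℂ) : ℝ → ℝ → ℂ :=
  fun x v => pX f x v * pV h x v - pV f x v * pX h x v

/-- The filtered HMF mean-field potential `φ(t,g)(x,v) = ∫ cos(x-y+t(v-u)) g(t,y,u) dy du`. -/
def phiHMF (g : ℝ → ℝ → ℝ → ℂ) (t : ℝ) : ℝ → ℝ → ℂ :=
  fun x v => ∫ z, (Real.cos (x - z.1 + t * (v - z.2)) : ℂ) * g t z.1 z.2 ∂μTR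

/-- `g` solves the filtered Vlasov-HMF equation `∂ₜg = {φ(t,g), η} + ε{φ(t,g), g}`. -/
def IsVHMF (ε : ℝ) (η : ℝ → ℂ) (g : ℝ → ℝ → ℝ → ℂ) : Prop :=
  ∀ t x v, HasDerivAt (fun τ => g τ x v)
    (pbracket (phiHMF g t) (fun _ w => η w) x v + ε * pbracket (phiHMF g t) (g t) x v) t

/-- Global smoothness (in all variables) of `g = g(t,x,v)`. -/
def SmoothG (g : ℝ → ℝ → ℝ → ℂ) : Prop :=
  ∀ n : ℕ, ContDiff ℝ n fun p : ℝ × ℝ × ℝ => g p.1 p.2.1 p.2.2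

/-- `ζₖ(t) = ĝₖ(t, kt)`. -/
def zeta (g : ℝ → ℝ → ℝ → ℂ) (k : ℤ) (t : ℝ) : ℂ := fHat (g t) k ((k : ℝ) * t)

/-- The bound `Q_{T,s}(g) ≤ R`, where
`Q_{T,s}(g) = sup_{[0,T]} ‖g(t)‖_{ℋˢ}/⟨t⟩³ + sup_{[0,T]} max_{k=±1} ⟨t⟩^{s-1}|ζₖ(t)| + sup_{[0,T]} ‖g(t)‖_{ℋ^{s-4}}`. -/
def Qle (m0 : ℝ) (s : ℕ) (g : ℝ → ℝ → ℝ → ℂ) (T R : ℝ) : Prop :=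
  ∃ A B C : ℝ, A + B + C ≤ R ∧
    (∀ t ∈ Set.Icc (0 : ℝ) T, Hnorm m0 s (g t) / jap t ^ 3 ≤ A) ∧
    (∀ t ∈ Set.Icc (0 : ℝ) T, ∀ k : ℤ, k = 1 ∨ k = -1 → jap t ^ (s - 1) * ‖zeta g k t‖ ≤ B) ∧
    (∀ t ∈ Set.Icc (0 : ℝ) T, Hnorm m0 (s - 4) (g t) ≤ C)

instance : SFinite μTR := by unfold μTR; infer_instance

/-- The character `e^{-ikx-iξv}`. -/
def character (k : ℤ) (ξ : ℝ) (x v : ℝ) : ℂ :=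
  Complex.exp (-Complex.I * ((k : ℝ) * x + ξ * v))

lemma fHat_eq (f : ℝ → ℝ → ℂ) (k : ℤ) (ξ : ℝ) :
    fHat f k ξ = (1 / (2 * π)) * ∫ z, f z.1 z.2 * character k ξ z.1 z.2 ∂μTR := rfl

lemma norm_character (k : ℤ) (ξ x v : ℝ) : ‖character k ξ x v‖ = 1 := by
  have : -Complex.I * ((k : ℝ) * x + ξ * v) = ((-(k * x + ξ * v) : ℝ) : ℂ) * Complex.I := by
    push_cast; ring
  rw [character, this, Complex.norm_exp_ofReal_mul_I]

lemma continuous_character (k : ℤ) (ξ : ℝ) :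
    Continuous (Function.uncurry (character k ξ)) := by
  unfold character Function.uncurry
  fun_prop

lemma character_add (k : ℤ) (ξ x v : ℝ) :
    character k ξ x v = character k ξ x 0 * character k ξ 0 v := by
  unfold character
  rw [← Complex.exp_add]
  congr 1
  push_cast
  ring

lemma character_periodic (k : ℤ) (ξ v : ℝ) :
    Function.Periodic (fun x => character k ξ x v) (2 * π) := by
  intro x
  unfold character
  rw [Complex.exp_eq_exp_iff_exists_int]
  refine ⟨-k, ?_⟩
  push_cast
  ring

lemma hasDerivAt_character_fst (k : ℤ) (ξ x v : ℝ) :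
    HasDerivAt (fun x => character k ξ x v) (-Complex.I * k * character k ξ x v) x := by
  have h : HasDerivAt (fun x : ℝ => -Complex.I * ((k : ℝ) * (x : ℂ) + ξ * v))
      (-Complex.I * k) x := by
    have := ((((hasDerivAt_id x).ofReal_comp).const_mul ((k : ℝ) : ℂ)).add_const
      ((ξ : ℂ) * v)).const_mul (-Complex.I)
    simpa using this
  exact h.cexp.congr_deriv (mul_comm _ _)

lemma hasDerivAt_character_snd (k : ℤ) (ξ x v : ℝ) :
    HasDerivAt (fun v => character k ξ x v) (-Complex.I * ξ * character k ξ x v) v := by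
  have h : HasDerivAt (fun v : ℝ => -Complex.I * ((k : ℝ) * (x : ℂ) + ξ * v))
      (-Complex.I * ξ) v := by
    have := ((((hasDerivAt_id v).ofReal_comp).const_mul (ξ : ℂ)).const_add
      (((k : ℝ) : ℂ) * x)).const_mul (-Complex.I)
    simpa using this
  exact h.cexp.congr_deriv (mul_comm _ _)

lemma integrable_mul_character {f : ℝ → ℝ → ℂ} (k : ℤ) (ξ : ℝ)
    (hf : Integrable (fun z : ℝ × ℝ => f z.1 z.2) μTR) :
    Integrable (fun z : ℝ × ℝ => f z.1 z.2 * character k ξ z.1 z.2) μTR :=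
  hf.mul_bdd (c := 1) (continuous_character k ξ).aestronglyMeasurable
    (Filter.Eventually.of_forall fun _ => (norm_character ..).le)

lemma setIntegral_periodic_sub {E : Type*} [NormedAddCommGroup E] [NormedSpace ℝ E]
    {h : ℝ → E} (hp : Function.Periodic h (2 * π)) (c : ℝ) :
    ∫ x in Ioc 0 (2 * π), h (x - c) = ∫ x in Ioc 0 (2 * π), h x := by
  rw [← intervalIntegral.integral_of_le two_pi_pos.le,
    ← intervalIntegral.integral_of_le two_pi_pos.le, intervalIntegral.integral_comp_sub_right]
  have := hp.intervalIntegral_add_eq (0 - c) 0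
  rw [zero_add] at this
  rw [← this]
  congr 1
  ring

lemma integrable_shear {h : ℝ → ℝ → ℂ} (hc : Continuous (Function.uncurry h))
    (hp : ∀ v, Function.Periodic (fun x => h x v) (2 * π))
    (hi : Integrable (fun z : ℝ × ℝ => h z.1 z.2) μTR) (t : ℝ) :
    Integrable (fun z : ℝ × ℝ => h (z.1 - t * z.2) z.2) μTR := by
  have hc' : Continuous (fun z : ℝ × ℝ => h (z.1 - t * z.2) z.2) :=
    hc.comp (f := fun z : ℝ × ℝ => (z.1 - t * z.2, z.2)) (by fun_prop)
  have hi' := ((integrable_prod_iff' hi.aestronglyMeasurable).1 hi).2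
  refine (integrable_prod_iff' hc'.aestronglyMeasurable).2 ⟨?_, ?_⟩
  · refine Filter.Eventually.of_forall fun v => ?_
    have : Continuous fun x => h (x - t * v) v :=
      hc.comp (f := fun x : ℝ => (x - t * v, v)) (by fun_prop)
    exact (this.integrableOn_Icc (a := 0) (b := 2 * π)).mono_set Ioc_subset_Icc_self
  · refine hi'.congr (Filter.Eventually.of_forall fun v => ?_)
    exact (setIntegral_periodic_sub (h := fun x => ‖h x v‖)
      (fun x => congrArg norm (hp v x)) (t * v)).symm

lemma integral_shear {h : ℝ → ℝ → ℂ} (hc : Continuous (Function.uncurry h))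
    (hp : ∀ v, Function.Periodic (fun x => h x v) (2 * π))
    (hi : Integrable (fun z : ℝ × ℝ => h z.1 z.2) μTR) (t : ℝ) :
    ∫ z, h (z.1 - t * z.2) z.2 ∂μTR = ∫ z, h z.1 z.2 ∂μTR := by
  have hs := integrable_shear hc hp hi t
  unfold μTR at hs hi ⊢
  rw [integral_prod_symm _ hs, integral_prod_symm _ hi]
  congr 1
  ext v
  exact setIntegral_periodic_sub (hp v) (t * v)

lemma fHat_shear {f : ℝ → ℝ → ℂ} (hc : Continuous (Function.uncurry f))
    (hp : ∀ v, Function.Periodic (fun x => f x v) (2 * π))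
    (hi : Integrable (fun z : ℝ × ℝ => f z.1 z.2) μTR) (n : ℤ) (ξ t : ℝ) :
    fHat (fun x v => f (x - t * v) v) n ξ = fHat f n (ξ + n * t) := by
  rw [fHat_eq, fHat_eq, ← integral_shear
    (h := fun x v => f x v * character n (ξ + n * t) x v)
    (hc.mul (continuous_character n (ξ + n * t)))
    (fun v => (hp v).mul (character_periodic n (ξ + n * t) v))
    (integrable_mul_character n _ hi) t]
  congr 2
  ext z
  congr 1
  unfold character
  congr 1
  push_cast
  ring

lemma fHat_homogeneous (η : ℝ → ℂ) {n : ℤ} (hn : n ≠ 0) (ξ : ℝ) :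
    fHat (fun _ v => η v) n ξ = 0 := by
  have h0 : ∫ x in Ioc 0 (2 * π), character n ξ x 0 = 0 := by
    rw [← intervalIntegral.integral_of_le two_pi_pos.le]
    have hne : -Complex.I * (n : ℂ) ≠ 0 := by simp [hn]
    have hint := intervalIntegral.integral_eq_sub_of_hasDerivAt (a := 0) (b := 2 * π)
      (fun x _ => hasDerivAt_character_fst n ξ x 0)
      (Continuous.intervalIntegrable (continuous_const.mul
        ((continuous_character n ξ).comp (f := fun x : ℝ => (x, (0 : ℝ))) (by fun_prop))) _ _)
    have hper := character_periodic n ξ 0 0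
    simp only [zero_add] at hper
    rw [hper, sub_self, intervalIntegral.integral_const_mul] at hint
    exact (mul_eq_zero.1 hint).resolve_left hne
  rw [fHat_eq]
  have : (fun z : ℝ × ℝ => η z.2 * character n ξ z.1 z.2) =
      fun z => character n ξ z.1 0 * (η z.2 * character n ξ 0 z.2) := by
    ext z
    rw [character_add]
    ring
  rw [this, μTR, integral_prod_mul (fun x => character n ξ x 0)
    (fun v => η v * character n ξ 0 v), h0]
  simp

lemma hasDerivAt_pX {f : ℝ → ℝ → ℂ} (hf : ContDiff ℝ 1 (Function.uncurry f)) (x v : ℝ) :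
    HasDerivAt (fun x => f x v) (pX f x v) x := by
  have : ContDiff ℝ 1 fun x => f x v :=
    hf.comp (f := fun x : ℝ => (x, v)) (by fun_prop)
  exact (this.differentiable one_ne_zero x).hasDerivAt

lemma hasDerivAt_pV {f : ℝ → ℝ → ℂ} (hf : ContDiff ℝ 1 (Function.uncurry f)) (x v : ℝ) :
    HasDerivAt (fun v => f x v) (pV f x v) v := by
  have : ContDiff ℝ 1 fun v => f x v :=
    hf.comp (f := fun v : ℝ => (x, v)) (by fun_prop)
  exact (this.differentiable one_ne_zero v).hasDerivAt

open scoped ContDiff in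
lemma ContDiff.pX {f : ℝ → ℝ → ℂ} (hf : ContDiff ℝ ∞ (Function.uncurry f)) :
    ContDiff ℝ ∞ (Function.uncurry (pX f)) := by
  have h1 : ContDiff ℝ 1 (Function.uncurry f) := hf.of_le (by simp)
  have : Function.uncurry (_root_.pX f) =
      fun z => fderiv ℝ (Function.uncurry f) z ((1, 0) : ℝ × ℝ) := by
    ext ⟨x, v⟩
    have hd := (h1.differentiable one_ne_zero (x, v)).hasFDerivAt.comp_hasDerivAt x
      ((hasDerivAt_id x).prodMk (hasDerivAt_const x v))
    exact (hasDerivAt_pX h1 x v).unique hd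
  rw [this]
  exact (hf.fderiv_right (by simp)).clm_apply contDiff_const

open scoped ContDiff in
lemma ContDiff.pV {f : ℝ → ℝ → ℂ} (hf : ContDiff ℝ ∞ (Function.uncurry f)) :
    ContDiff ℝ ∞ (Function.uncurry (pV f)) := by
  have h1 : ContDiff ℝ 1 (Function.uncurry f) := hf.of_le (by simp)
  have : Function.uncurry (_root_.pV f) =
      fun z => fderiv ℝ (Function.uncurry f) z ((0, 1) : ℝ × ℝ) := by
    ext ⟨x, v⟩
    have hd := (h1.differentiable one_ne_zero (x, v)).hasFDerivAt.comp_hasDerivAt v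
      ((hasDerivAt_const v x).prodMk (hasDerivAt_id v))
    exact (hasDerivAt_pV h1 x v).unique hd
  rw [this]
  exact (hf.fderiv_right (by simp)).clm_apply contDiff_const

lemma periodic_pX {f : ℝ → ℝ → ℂ} (hp : ∀ v, Function.Periodic (fun x => f x v) (2 * π)) (v : ℝ) :
    Function.Periodic (fun x => pX f x v) (2 * π) := by
  intro x
  have h := deriv_comp_add_const (fun x => f x v) (2 * π) x
  rw [show (fun x => f (x + 2 * π) v) = fun x => f x v from funext (hp v)] at h
  exact h.symm

lemma periodic_pV {f : ℝ → ℝ → ℂ} (hp : ∀ v, Function.Periodic (fun x => f x v) (2 * π)) (v : ℝ) :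
    Function.Periodic (fun x => pV f x v) (2 * π) := by
  intro x
  simp only [pV]
  rw [show (fun v' => f (x + 2 * π) v') = fun v' => f x v' from funext fun v' => hp v' x]

lemma fHat_pX {f : ℝ → ℝ → ℂ} (hf : ContDiff ℝ 1 (Function.uncurry f))
    (hp : ∀ v, Function.Periodic (fun x => f x v) (2 * π))
    (hi : Integrable (fun z : ℝ × ℝ => f z.1 z.2) μTR)
    (hi' : Integrable (fun z : ℝ × ℝ => pX f z.1 z.2) μTR) (n : ℤ) (ξ : ℝ) :
    fHat (pX f) n ξ = Complex.I * n * fHat f n ξ := by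
  have h1 := integrable_mul_character n ξ hi
  have h2 := integrable_mul_character n ξ hi'
  rw [fHat_eq, fHat_eq, mul_left_comm, ← integral_const_mul (Complex.I * n)]
  congr 1
  have h3 := h1.const_mul (Complex.I * n)
  have h4 : Integrable (fun z : ℝ × ℝ => pX f z.1 z.2 * character n ξ z.1 z.2 -
      Complex.I * n * (f z.1 z.2 * character n ξ z.1 z.2)) μTR := h2.sub h3
  rw [← sub_eq_zero, ← integral_sub h2 h3]
  unfold μTR at h4 ⊢
  rw [integral_prod_symm _ h4]
  refine integral_eq_zero_of_ae ?_
  filter_upwards [h4.prod_left_ae] with v hv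
  rw [← intervalIntegral.integral_of_le two_pi_pos.le]
  have hd : ∀ x ∈ uIcc 0 (2 * π), HasDerivAt (fun x => f x v * character n ξ x v)
      (pX f x v * character n ξ x v - Complex.I * n * (f x v * character n ξ x v)) x := by
    intro x _
    exact ((hasDerivAt_pX hf x v).mul (hasDerivAt_character_fst n ξ x v)).congr_deriv
      (by ring)
  have := intervalIntegral.integral_eq_sub_of_hasDerivAt hd
    ((intervalIntegrable_iff_integrableOn_Ioc_of_le two_pi_pos.le).2 hv)
  have hper := ((hp v).mul (character_periodic n ξ v)) 0
  simp only [zero_add, Pi.mul_apply] at hper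
  rw [hper, sub_self] at this
  exact this

lemma fHat_pV {f : ℝ → ℝ → ℂ} (hf : ContDiff ℝ 1 (Function.uncurry f))
    (hi : Integrable (fun z : ℝ × ℝ => f z.1 z.2) μTR)
    (hi' : Integrable (fun z : ℝ × ℝ => pV f z.1 z.2) μTR) (n : ℤ) (ξ : ℝ) :
    fHat (pV f) n ξ = Complex.I * ξ * fHat f n ξ := by
  have h1 := integrable_mul_character n ξ hi
  have h2 := integrable_mul_character n ξ hi'
  rw [fHat_eq, fHat_eq, mul_left_comm, ← integral_const_mul (Complex.I * ξ)]
  congr 1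
  have h3 := h1.const_mul (Complex.I * ξ)
  have h4 : Integrable (fun z : ℝ × ℝ => pV f z.1 z.2 * character n ξ z.1 z.2 -
      Complex.I * ξ * (f z.1 z.2 * character n ξ z.1 z.2)) μTR := h2.sub h3
  rw [← sub_eq_zero, ← integral_sub h2 h3]
  unfold μTR at h1 h4 ⊢
  rw [integral_prod _ h4]
  refine integral_eq_zero_of_ae ?_
  filter_upwards [h1.prod_right_ae, h4.prod_right_ae] with x hx hx'
  have hd : ∀ v, HasDerivAt (fun v => f x v * character n ξ x v)
      (pV f x v * character n ξ x v - Complex.I * ξ * (f x v * character n ξ x v)) v := by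
    intro v
    exact ((hasDerivAt_pV hf x v).mul (hasDerivAt_character_snd n ξ x v)).congr_deriv
      (by ring)
  exact integral_eq_zero_of_hasDerivAt_of_integrable hd hx' hx

lemma integrable_inv_weight {m0 : ℝ} (hm0 : 1 / 2 < m0) :
    Integrable (fun z : ℝ × ℝ => (1 + z.2 ^ 2) ^ (-m0)) μTR := by
  have h := integrable_rpow_neg_one_add_norm_sq (E := ℝ) (μ := volume) (r := 2 * m0)
    (by simp; linarith)
  have h' : Integrable (fun v : ℝ => (1 + v ^ 2) ^ (-m0)) := by
    refine h.congr (Filter.Eventually.of_forall fun v => ?_)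
    simp only [Real.norm_eq_abs, sq_abs]
    congr 1
    ring
  have h1 : Integrable (fun _ : ℝ => (1 : ℝ)) (volume.restrict (Ioc 0 (2 * π))) :=
    integrable_const 1
  simpa [μTR] using h1.mul_prod h'

lemma norm_le_weighted (m0 : ℝ) (f : ℝ → ℝ → ℂ) (z : ℝ × ℝ) :
    ‖f z.1 z.2‖ ≤ wInt m0 0 0 f z + (1 + z.2 ^ 2) ^ (-m0) := by
  have hw : 0 < (1 + z.2 ^ 2) ^ m0 := by positivity
  simp only [wInt, Function.iterate_zero, id]
  rw [Real.rpow_neg (by positivity)]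
  generalize (1 + z.2 ^ 2) ^ m0 = w at hw
  have h1 : w * ‖f z.1 z.2‖ ^ 2 + w⁻¹ - ‖f z.1 z.2‖ =
      w⁻¹ * ((w * ‖f z.1 z.2‖ - 1 / 2) ^ 2 + 3 / 4) := by
    field_simp
    ring
  have h2 : 0 ≤ w⁻¹ * ((w * ‖f z.1 z.2‖ - 1 / 2) ^ 2 + 3 / 4) := by positivity
  linarith

lemma integrable_of_wInt {m0 : ℝ} (hm0 : 1 / 2 < m0) {f : ℝ → ℝ → ℂ}
    (hf : Continuous (Function.uncurry f)) (hi : Integrable (wInt m0 0 0 f) μTR) :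
    Integrable (fun z : ℝ × ℝ => f z.1 z.2) μTR :=
  (hi.add (integrable_inv_weight hm0)).mono' hf.aestronglyMeasurable
    (Filter.Eventually.of_forall (norm_le_weighted m0 f))

lemma norm_fHat_le {m0 : ℝ} (hm0 : 1 / 2 < m0) {f : ℝ → ℝ → ℂ}
    (hi : Integrable (wInt m0 0 0 f) μTR) (n : ℤ) (ξ : ℝ) :
    ‖fHat f n ξ‖ ≤ ∫ z, wInt m0 0 0 f z ∂μTR + ∫ z, (1 + z.2 ^ 2) ^ (-m0) ∂μTR := by
  have hw := integrable_inv_weight hm0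
  rw [← integral_add hi hw, fHat_eq, norm_mul]
  have h1 : ‖(1 / (2 * π) : ℂ)‖ ≤ 1 := by
    rw [show (1 / (2 * π) : ℂ) = ((1 / (2 * π) : ℝ) : ℂ) by push_cast; rfl,
      Complex.norm_of_nonneg (by positivity)]
    rw [div_le_one two_pi_pos]
    linarith [pi_gt_three]
  have h2 : ‖∫ z, f z.1 z.2 * character n ξ z.1 z.2 ∂μTR‖ ≤
      ∫ z, (wInt m0 0 0 f z + (1 + z.2 ^ 2) ^ (-m0)) ∂μTR := by
    refine norm_integral_le_of_norm_le (hi.add hw) (Filter.Eventually.of_forall fun z => ?_)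
    rw [norm_mul, norm_character, mul_one]
    exact norm_le_weighted m0 f z
  exact (mul_le_of_le_one_left (norm_nonneg _) h1).trans h2

lemma wInt_nonneg (m0 : ℝ) (p q : ℕ) (f : ℝ → ℝ → ℂ) (z : ℝ × ℝ) : 0 ≤ wInt m0 p q f z := by
  unfold wInt
  positivity

lemma integral_wInt_le_HnormSq (m0 : ℝ) {n p q : ℕ} (hpq : p + q ≤ n) (f : ℝ → ℝ → ℂ) :
    ∫ z, wInt m0 p q f z ∂μTR ≤ HnormSq m0 n f := by
  have h0 : ∀ p q, 0 ≤ ∫ z, wInt m0 p q f z ∂μTR := fun p q =>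
    integral_nonneg (wInt_nonneg m0 p q f)
  refine le_trans ?_ (Finset.single_le_sum
    (f := fun p => ∑ q ∈ Finset.range (n + 1 - p), ∫ z, wInt m0 p q f z ∂μTR)
    (fun p _ => Finset.sum_nonneg fun q _ => h0 p q)
    (Finset.mem_range.2 (by omega : p < n + 1)))
  exact Finset.single_le_sum (f := fun q => ∫ z, wInt m0 p q f z ∂μTR) (fun q _ => h0 p q)
    (Finset.mem_range.2 (by omega : q < n + 1 - p))

section Derivatives

variable {f : ℝ → ℝ → ℂ}

open scoped ContDiff

lemma contDiff_iterate (hf : ContDiff ℝ ∞ (Function.uncurry f)) (p q : ℕ) :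
    ContDiff ℝ ∞ (Function.uncurry (pX^[p] (pV^[q] f))) := by
  have hq : ContDiff ℝ ∞ (Function.uncurry (pV^[q] f)) := by
    induction q with
    | zero => exact hf
    | succ q ih => rw [Function.iterate_succ_apply']; exact ih.pV
  induction p with
  | zero => exact hq
  | succ p ih => rw [Function.iterate_succ_apply']; exact ih.pX

lemma periodic_iterate (hp : ∀ v, Function.Periodic (fun x => f x v) (2 * π)) (p q : ℕ) :
    ∀ v, Function.Periodic (fun x => (pX^[p] (pV^[q] f)) x v) (2 * π) := by
  have hq : ∀ v, Function.Periodic (fun x => (pV^[q] f) x v) (2 * π) := by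
    induction q with
    | zero => exact hp
    | succ q ih => rw [Function.iterate_succ_apply']; exact periodic_pV ih
  induction p with
  | zero => exact hq
  | succ p ih => rw [Function.iterate_succ_apply']; exact periodic_pX ih

lemma integrable_iterate {m0 : ℝ} (hm0 : 1 / 2 < m0) {N : ℕ}
    (hf : ContDiff ℝ ∞ (Function.uncurry f)) (hH : MemH m0 N f) {p q : ℕ} (hpq : p + q ≤ N) :
    Integrable (fun z : ℝ × ℝ => (pX^[p] (pV^[q] f)) z.1 z.2) μTR :=
  integrable_of_wInt hm0 (contDiff_iterate hf p q).continuous (hH.2.2 p q hpq)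

lemma fHat_iterate {m0 : ℝ} (hm0 : 1 / 2 < m0) {N : ℕ}
    (hf : ContDiff ℝ ∞ (Function.uncurry f)) (hH : MemH m0 N f) {p q : ℕ} (hpq : p + q ≤ N)
    (n : ℤ) (ξ : ℝ) :
    fHat (pX^[p] (pV^[q] f)) n ξ = (Complex.I * n) ^ p * (Complex.I * ξ) ^ q * fHat f n ξ := by
  induction p with
  | zero =>
    induction q with
    | zero => simp
    | succ q ih =>
      have h1 := integrable_iterate hm0 hf hH (p := 0) (q := q) (by omega)
      have h2 := integrable_iterate hm0 hf hH (p := 0) (q := q + 1) (by omega)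
      have h3 := (contDiff_iterate hf 0 q).of_le (m := 1) (by simp)
      have ih := ih (by omega)
      simp only [Function.iterate_zero, id, Function.iterate_succ_apply'] at h1 h2 h3 ih ⊢
      rw [fHat_pV h3 h1 h2, ih]
      ring
  | succ p ih =>
    have h1 := integrable_iterate hm0 hf hH (p := p) (q := q) (by omega)
    have h2 := integrable_iterate hm0 hf hH (p := p + 1) (q := q) (by omega)
    have h3 := (contDiff_iterate hf p q).of_le (m := 1) (by simp)
    have ih := ih (by omega)
    rw [Function.iterate_succ_apply'] at h2 ⊢
    rw [fHat_pX h3 (periodic_iterate hH.2.1 p q) h1 h2, ih]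
    ring

lemma pow_mul_norm_fHat_le {m0 : ℝ} (hm0 : 1 / 2 < m0) {N M : ℕ}
    (hf : ContDiff ℝ ∞ (Function.uncurry f)) (hH : MemH m0 N f) (hMN : M ≤ N)
    {p q : ℕ} (hpq : p + q ≤ M) (n : ℤ) (ξ : ℝ) :
    |(n : ℝ)| ^ p * |ξ| ^ q * ‖fHat f n ξ‖ ≤
      HnormSq m0 M f + ∫ z, (1 + z.2 ^ 2) ^ (-m0) ∂μTR := by
  have h := norm_fHat_le hm0 (f := pX^[p] (pV^[q] f)) (hH.2.2 p q (hpq.trans hMN)) n ξ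
  rw [fHat_iterate hm0 hf hH (hpq.trans hMN)] at h
  simp only [norm_mul, norm_pow, Complex.norm_I, one_mul, Complex.norm_intCast,
    Complex.norm_real, Real.norm_eq_abs] at h
  exact h.trans (add_le_add_left (integral_wInt_le_HnormSq m0 hpq f) _)

end Derivatives

lemma jap_pos (t : ℝ) : 0 < jap t := Real.sqrt_pos.2 (by positivity)

lemma jap_le_one_add_abs (t : ℝ) : jap t ≤ 1 + |t| := by
  refine Real.sqrt_le_iff.2 ⟨by positivity, ?_⟩
  nlinarith [sq_abs t, abs_nonneg t]

lemma jap_pow_le (t : ℝ) (a : ℕ) : jap t ^ a ≤ 2 ^ a * (1 + |t| ^ a) := by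
  calc jap t ^ a ≤ (1 + |t|) ^ a := pow_le_pow_left₀ (jap_pos t).le (jap_le_one_add_abs t) a
    _ ≤ (2 * max 1 |t|) ^ a :=
      pow_le_pow_left₀ (by positivity)
        (by linarith [le_max_left 1 |t|, le_max_right 1 |t|]) a
    _ = 2 ^ a * max 1 |t| ^ a := mul_pow ..
    _ ≤ 2 ^ a * (1 + |t| ^ a) := by
      gcongr
      rcases max_cases 1 |t| with h | h <;> rw [h.1]
      · rw [one_pow]
        exact le_add_of_nonneg_right (by positivity)
      · linarith

lemma jap_intCast_pow_le {n : ℤ} (hn : n ≠ 0) (b : ℕ) :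
    jap (n : ℝ) ^ b ≤ 2 ^ b * |(n : ℝ)| ^ b := by
  have h1 : (1 : ℝ) ≤ |(n : ℝ)| := by exact_mod_cast Int.one_le_abs hn
  rw [← mul_pow]
  exact pow_le_pow_left₀ (jap_pos _).le (by linarith [jap_le_one_add_abs (n : ℝ)]) b

lemma Qle.Hnorm_le {m0 : ℝ} {s : ℕ} {g : ℝ → ℝ → ℝ → ℂ} {T R : ℝ} (hT : 0 ≤ T)
    (h : Qle m0 s g T R) : Hnorm m0 (s - 4) (g T) ≤ R := by
  obtain ⟨A, B, C, hsum, hA, hB, hC⟩ := h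
  have hmem : T ∈ Icc 0 T := ⟨hT, le_rfl⟩
  have hA0 : 0 ≤ A :=
    (div_nonneg (Real.sqrt_nonneg _) (pow_pos (jap_pos T) 3).le).trans (hA T hmem)
  have hB0 : 0 ≤ B :=
    (mul_nonneg (pow_pos (jap_pos T) _).le (norm_nonneg _)).trans (hB T hmem 1 (Or.inl rfl))
  linarith [hC T hmem]

/-- **Nonlinear Landau damping.** Under the hypotheses of the main a priori bound, the
solution `f(t,x,v) = η(v) + ε g(t, x-tv, v)` of the Vlasov-HMF equation satisfies
`|f̂ₙ(t,ξ)| ≤ Cε / (⟨ξ+nt⟩^α ⟨n⟩^β)` for all `n ≠ 0`, `ξ ∈ ℝ`, `t ≥ 0` and all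
nonnegative integers `α + β = s - 4`; in particular every nonzero spatial Fourier mode of
`f` decays to zero with a polynomial rate. -/
theorem landau_damping (s : ℕ) (hs : 7 ≤ s) (m0 : ℝ) (hm0 : 1 / 2 < m0)
    (η : ℝ → ℂ) (hη : MemH m0 (s + 4) fun _ v => η v) (hP : Penrose m0 η)
    (R0 R ε : ℝ) (hR0 : 0 < R0) (hR : 0 < R) (hε : 0 < ε)
    (g : ℝ → ℝ → ℝ → ℂ) (hg : SmoothG g) (hgH : ∀ t : ℝ, MemH m0 s (g t))
    (hsol : IsVHMF ε η g) (hQ0 : Qle m0 s g 0 R0)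
    (hQ : ∀ T : ℝ, 0 ≤ T → Qle m0 s g T R) :
    ∃ C : ℝ, ∀ n : ℤ, n ≠ 0 → ∀ ξ : ℝ, ∀ t : ℝ, 0 ≤ t → ∀ α β : ℕ, α + β = s - 4 →
      ‖fHat (fun x v => η v + (ε : ℂ) * g t (x - t * v) v) n ξ‖ ≤
        C * ε / (jap (ξ + (n : ℝ) * t) ^ α * jap (n : ℝ) ^ β) := by
  set W : ℝ := ∫ z, (1 + z.2 ^ 2) ^ (-m0) ∂μTR
  refine ⟨2 ^ (s - 4) * (2 * (R ^ 2 + W)), fun n hn ξ t ht α β hαβ => ?_⟩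
  have hgt : ContDiff ℝ (⊤ : ℕ∞) (Function.uncurry (g t)) := by
    refine contDiff_infty.2 fun k => ?_
    exact (hg k).comp (f := fun z : ℝ × ℝ => (t, z.1, z.2)) (by fun_prop)
  have hgi : Integrable (fun z : ℝ × ℝ => g t z.1 z.2) μTR :=
    integrable_of_wInt hm0 hgt.continuous ((hgH t).2.2 0 0 (by omega))
  have hηi : Integrable (fun z : ℝ × ℝ => η z.2) μTR :=
    integrable_of_wInt (f := fun _ v => η v) hm0 hη.1.continuous (hη.2.2 0 0 (by omega))
  have hsplit : fHat (fun x v => η v + (ε : ℂ) * g t (x - t * v) v) n ξ =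
      ε * fHat (g t) n (ξ + n * t) := by
    rw [← fHat_shear hgt.continuous (hgH t).2.1 hgi n ξ t,
      ← zero_add (_ * fHat _ n ξ), ← fHat_homogeneous η hn ξ]
    simp only [fHat_eq, add_mul, mul_assoc]
    rw [integral_add (integrable_mul_character (f := fun _ v => η v) n ξ hηi)
      ((integrable_mul_character (f := fun x v => g t (x - t * v) v) n ξ
        (integrable_shear hgt.continuous (hgH t).2.1 hgi t)).const_mul _), integral_const_mul]
    ring
  have hH : HnormSq m0 (s - 4) (g t) ≤ R ^ 2 :=
    (Real.sqrt_le_left hR.le).1 (Qle.Hnorm_le ht (hQ t ht))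
  rw [hsplit, norm_mul, Complex.norm_of_nonneg hε.le, mul_comm _ ε, mul_div_assoc]
  refine mul_le_mul_of_nonneg_left ?_ hε.le
  have hα := jap_pos (ξ + n * t)
  have hβ := jap_pos (n : ℝ)
  rw [le_div_iff₀ (by positivity)]
  have h0 := pow_mul_norm_fHat_le hm0 hgt (hgH t) (M := s - 4) (by omega) (p := β) (q := 0)
    (by omega) n (ξ + n * t)
  have h1 := pow_mul_norm_fHat_le hm0 hgt (hgH t) (M := s - 4) (by omega) (p := β) (q := α)
    (by omega) n (ξ + n * t)
  calc ‖fHat (g t) n (ξ + n * t)‖ * (jap (ξ + n * t) ^ α * jap (n : ℝ) ^ β)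
      ≤ ‖fHat (g t) n (ξ + n * t)‖ *
          ((2 ^ α * (1 + |ξ + n * t| ^ α)) * (2 ^ β * |(n : ℝ)| ^ β)) := by
        gcongr
        · exact jap_pow_le _ _
        · exact jap_intCast_pow_le hn β
    _ = 2 ^ (s - 4) * (|(n : ℝ)| ^ β * |ξ + n * t| ^ 0 * ‖fHat (g t) n (ξ + n * t)‖ +
          |(n : ℝ)| ^ β * |ξ + n * t| ^ α * ‖fHat (g t) n (ξ + n * t)‖) := by
        rw [← hαβ]
        ring
    _ ≤ 2 ^ (s - 4) * (2 * (R ^ 2 + W)) := by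
        gcongr
        linarith
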